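/- For every k in N, the sum over multi-indices of length k of diagonal special Hermite functions satisfies (2\pi)^d \sum_{|\beta| = k} \Phi_{\beta,\beta}(z) = L_k^{d-1}(|z|^2/2) e^{-|z|^2/4} for all z in R^{2d}. -/

import Mathlib

open MeasureTheory Real

noncomputable section

/-- Euclidean dot product on `ℝ^d`. -/
def dotp {d : ℕ} (x y : Fin d → ℝ) : ℝ := ∑ j, x j * y j

/-- Ambiguity transform
`A(f,g)(x,ξ) = (2π)^{-d} ∫ e^{-iξ·y} f(y+x/2) conj(g(y-x/2)) dy`. -/
def ambiguity {d : ℕ} (f g : (Fin d → ℝ) → ℂ) (p : (Fin d → ℝ) × (Fin d → ℝ)) : ℂ :=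
  ((((2 * π : ℝ)) ^ d)⁻¹ : ℝ) *
    ∫ y : Fin d → ℝ, Complex.exp (-Complex.I * (dotp p.2 y : ℝ)) *
      f (y + (1 / 2 : ℝ) • p.1) * (starRingEnd ℂ) (g (y - (1 / 2 : ℝ) • p.1))

/-- Hermite polynomial. -/
def hermitePoly (n : ℕ) (y : ℝ) : ℝ :=
  (-1 : ℝ) ^ n * Real.exp (y ^ 2) * iteratedDeriv n (fun t => Real.exp (-t ^ 2)) y

/-- Normalized one-dimensional Hermite function. -/
def hermiteFun (n : ℕ) (y : ℝ) : ℝ :=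
  ((2 : ℝ) ^ n * (n.factorial : ℝ) * Real.sqrt π) ^ (-(1 : ℝ) / 2) *
    Real.exp (-y ^ 2 / 2) * hermitePoly n y

/-- `d`-dimensional Hermite function. -/
def hermiteFunD {d : ℕ} (α : Fin d → ℕ) (x : Fin d → ℝ) : ℂ :=
  ((∏ j, hermiteFun (α j) (x j) : ℝ) : ℂ)

/-- Special Hermite function `Φ_{α,β}(z) = A(Φ_α, Φ_β)(Jz)`, where `J(x,ξ) = (ξ,-x)`. -/
def specialHermite {d : ℕ} (α β : Fin d → ℕ)
    (z : (Fin d → ℝ) × (Fin d → ℝ)) : ℂ :=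
  ambiguity (hermiteFunD α) (hermiteFunD β) (z.2, -z.1)

/-- Laguerre polynomial of integer type `δ` and degree `n`. -/
def laguerre (δ n : ℕ) (y : ℝ) : ℝ :=
  ∑ i ∈ Finset.range (n + 1),
    (-1 : ℝ) ^ i * ((n + δ).choose (n - i) : ℝ) * y ^ i / (i.factorial : ℝ)

/-- The power series `∑ₙ Lₙ^δ(y) Xⁿ`, in the closed form `(1 - X)^{-(δ+1)} exp(-yX/(1-X))`. -/
def laguerreSeries (δ : ℕ) (y : ℝ) : PowerSeries ℝ :=
  (PowerSeries.invOneSubPow ℝ (δ + 1)).val *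
    (PowerSeries.rescale (-y) (PowerSeries.exp ℝ)).subst
      (PowerSeries.X * (PowerSeries.invOneSubPow ℝ 1).val)

lemma hasSubst_X_mul_invOneSubPow :
    PowerSeries.HasSubst (PowerSeries.X * (PowerSeries.invOneSubPow ℝ 1).val : PowerSeries ℝ) :=
  PowerSeries.HasSubst.of_constantCoeff_zero' (by simp)

lemma laguerreSeries_mul (a b : ℕ) (x y : ℝ) :
    laguerreSeries a x * laguerreSeries b y = laguerreSeries (a + b + 1) (x + y) := by
  have h := PowerSeries.invOneSubPow_add ℝ (a + 1) (b + 1)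
  rw [show a + 1 + (b + 1) = a + b + 1 + 1 by ring] at h
  rw [laguerreSeries, laguerreSeries, laguerreSeries, h, Units.val_mul, neg_add,
    ← PowerSeries.exp_mul_exp_eq_exp_add, PowerSeries.subst_mul hasSubst_X_mul_invOneSubPow]
  ring

lemma prod_laguerreSeries (d : ℕ) (y : Fin (d + 1) → ℝ) :
    ∏ j, laguerreSeries 0 (y j) = laguerreSeries d (∑ j, y j) := by
  induction d with
  | zero => simp
  | succ d ih =>
    rw [Fin.prod_univ_succ, Fin.sum_univ_succ, ih, laguerreSeries_mul, zero_add]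

lemma invOneSubPow_succ_mul_pow (δ i : ℕ) :
    (PowerSeries.invOneSubPow ℝ (δ + 1)).val *
        (PowerSeries.X * (PowerSeries.invOneSubPow ℝ 1).val) ^ i =
      PowerSeries.X ^ i * (PowerSeries.invOneSubPow ℝ (δ + i + 1)).val := by
  have h : PowerSeries.invOneSubPow ℝ (δ + i + 1) =
      PowerSeries.invOneSubPow ℝ (δ + 1) * PowerSeries.invOneSubPow ℝ 1 ^ i := by
    simp only [PowerSeries.invOneSubPow_eq_inv_one_sub_pow, pow_one]
    rw [← pow_add]
    congr 1
    ring
  rw [h, Units.val_mul, Units.val_pow_eq_pow_val]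
  ring

lemma coeff_subst_eq_sum_range (f : PowerSeries ℝ) {m n : ℕ} (h : m ≤ n) :
    PowerSeries.coeff m
        (f.subst (PowerSeries.X * (PowerSeries.invOneSubPow ℝ 1).val : PowerSeries ℝ)) =
      ∑ i ∈ Finset.range (n + 1), PowerSeries.coeff i f *
        PowerSeries.coeff m ((PowerSeries.X * (PowerSeries.invOneSubPow ℝ 1).val) ^ i) := by
  rw [PowerSeries.coeff_subst' hasSubst_X_mul_invOneSubPow]
  refine finsum_eq_sum_of_support_subset _ fun i hi => ?_
  by_contra hin
  refine hi ?_
  have : ¬ i ≤ m := by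
    simp only [Finset.coe_range, Set.mem_Iio] at hin
    omega
  simp [mul_pow, PowerSeries.coeff_X_pow_mul', this]

lemma coeff_laguerreSeries (δ n : ℕ) (y : ℝ) :
    PowerSeries.coeff n (laguerreSeries δ y) = laguerre δ n y := by
  rw [laguerreSeries, PowerSeries.coeff_mul]
  have h : ∀ p ∈ Finset.HasAntidiagonal.antidiagonal n,
      PowerSeries.coeff p.1 (PowerSeries.invOneSubPow ℝ (δ + 1)).val *
        PowerSeries.coeff p.2 ((PowerSeries.rescale (-y) (PowerSeries.exp ℝ)).subst
          (PowerSeries.X * (PowerSeries.invOneSubPow ℝ 1).val : PowerSeries ℝ)) =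
      ∑ i ∈ Finset.range (n + 1),
        PowerSeries.coeff i (PowerSeries.rescale (-y) (PowerSeries.exp ℝ)) *
        (PowerSeries.coeff p.1 (PowerSeries.invOneSubPow ℝ (δ + 1)).val *
        PowerSeries.coeff p.2 ((PowerSeries.X * (PowerSeries.invOneSubPow ℝ 1).val) ^ i)) := by
    intro p hp
    rw [coeff_subst_eq_sum_range _ (Finset.HasAntidiagonal.antidiagonal.snd_le hp), Finset.mul_sum]
    exact Finset.sum_congr rfl fun i _ => by ring
  rw [Finset.sum_congr rfl h, Finset.sum_comm, laguerre]
  refine Finset.sum_congr rfl fun i hi => ?_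
  have hin : i ≤ n := by simpa [Nat.lt_succ_iff] using hi
  rw [← Finset.mul_sum, ← PowerSeries.coeff_mul, invOneSubPow_succ_mul_pow,
    PowerSeries.coeff_X_pow_mul', if_pos hin, PowerSeries.invOneSubPow_val_succ_eq_mk_add_choose,
    PowerSeries.coeff_mk, PowerSeries.coeff_rescale, PowerSeries.coeff_exp,
    show δ + i + (n - i) = n + δ by omega,
    Nat.choose_symm_of_eq_add (show n + δ = (δ + i) + (n - i) by omega), neg_pow]
  simp
  ring

lemma tsum_prod_laguerre (d k : ℕ) (y : Fin (d + 1) → ℝ) :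
    ∑' β : {β : Fin (d + 1) → ℕ // ∑ j, β j = k}, ∏ j, laguerre 0 (β.1 j) (y j) =
      laguerre d k (∑ j, y j) := by
  rw [← coeff_laguerreSeries, ← prod_laguerreSeries, PowerSeries.coeff_prod]
  simp only [coeff_laguerreSeries]
  have hs : {β : Fin (d + 1) → ℕ | ∑ j, β j = k} =
      ↑(Finset.piAntidiag (Finset.univ : Finset (Fin (d + 1))) k) := by
    ext β; simp
  have := Finset.tsum_subtype' (Finset.piAntidiag (Finset.univ : Finset (Fin (d + 1))) k)
    fun β => ∏ j, laguerre 0 (β j) (y j)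
  rw [← hs] at this
  refine this.trans ?_
  refine Finset.sum_bij' (fun β _ => Finsupp.equivFunOnFinite.symm β) (fun l _ => ⇑l)
    ?_ ?_ ?_ ?_ ?_ <;> simp [Finset.mem_finsuppAntidiag]

open Polynomial in
/-- The physicists' Hermite polynomials, as elements of `ℝ[X]`. -/
def physHermite : ℕ → ℝ[X]
  | 0 => 1
  | n + 1 => 2 * X * physHermite n - derivative (physHermite n)

open Polynomial in
lemma derivative_physHermite_succ (n : ℕ) :
    derivative (physHermite (n + 1)) = (2 * (n + 1) : ℝ) • physHermite n := by
  induction n with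
  | zero => simp [physHermite, smul_eq_C_mul, ← C_ofNat]
  | succ n ih =>
    rw [physHermite, derivative_sub, derivative_mul, ih, derivative_smul]
    simp only [derivative_mul, derivative_ofNat, derivative_X, zero_mul, zero_add, mul_one]
    have : physHermite (n + 1) = 2 * X * physHermite n - derivative (physHermite n) := rfl
    simp only [smul_eq_C_mul, map_mul, map_add, map_natCast, map_ofNat, map_one, Nat.cast_add,
      Nat.cast_one, this]
    ring

lemma hasDerivAt_exp_neg_sq (t : ℝ) :
    HasDerivAt (fun t : ℝ => Real.exp (-t ^ 2)) (-(2 * t) * Real.exp (-t ^ 2)) t := by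
  convert! ((hasDerivAt_pow 2 t).neg).exp using 1
  simp
  ring

lemma iteratedDeriv_exp_neg_sq (n : ℕ) :
    iteratedDeriv n (fun t : ℝ => Real.exp (-t ^ 2)) =
      fun t => (-1) ^ n * (physHermite n).eval t * Real.exp (-t ^ 2) := by
  induction n with
  | zero => ext t; simp [physHermite]
  | succ n ih =>
    ext t
    rw [iteratedDeriv_succ, ih]
    refine HasDerivAt.deriv ?_
    convert! (((physHermite n).hasDerivAt t).const_mul ((-1 : ℝ) ^ n)).mul
      (hasDerivAt_exp_neg_sq t) using 1
    simp [physHermite]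
    ring

lemma hermitePoly_eq_eval (n : ℕ) (y : ℝ) : hermitePoly n y = (physHermite n).eval y := by
  rw [hermitePoly, iteratedDeriv_exp_neg_sq]
  have h1 : Real.exp (y ^ 2) * Real.exp (-y ^ 2) = 1 := by rw [← Real.exp_add]; simp
  have h2 : ((-1 : ℝ) ^ n) * (-1) ^ n = 1 := by rw [← mul_pow]; simp
  linear_combination (physHermite n).eval y * (h1 * (-1) ^ n * (-1) ^ n + h2)

/-- The modulated Gaussian `e^{-y² - iξy}`. -/
def modulatedGaussian (ξ y : ℝ) : ℂ := Complex.exp (-(y : ℂ) ^ 2 - Complex.I * ξ * y)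

lemma norm_modulatedGaussian (ξ y : ℝ) : ‖modulatedGaussian ξ y‖ = Real.exp (-y ^ 2) := by
  rw [modulatedGaussian, Complex.norm_exp]
  simp [← Complex.ofReal_pow]

lemma continuous_modulatedGaussian (ξ : ℝ) : Continuous (modulatedGaussian ξ) := by
  unfold modulatedGaussian; fun_prop

lemma hasDerivAt_modulatedGaussian (ξ y : ℝ) :
    HasDerivAt (modulatedGaussian ξ)
      (-(2 * y + Complex.I * ξ) * modulatedGaussian ξ y) y := by
  have h : HasDerivAt (fun w : ℂ => Complex.exp (-w ^ 2 - Complex.I * ξ * w))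
      (Complex.exp (-(y : ℂ) ^ 2 - Complex.I * ξ * y) * (-(2 * y) - Complex.I * ξ)) (y : ℂ) := by
    refine HasDerivAt.cexp ?_
    convert! ((hasDerivAt_pow 2 (y : ℂ)).neg).sub
      ((hasDerivAt_id (y : ℂ)).const_mul (Complex.I * ξ)) using 1
    simp
  convert! h.comp_ofReal using 1
  simp only [modulatedGaussian]
  ring

open Polynomial in
lemma integrable_modulatedGaussian_mul_eval (ξ : ℝ) (p : ℝ[X]) :
    Integrable fun y : ℝ => modulatedGaussian ξ y * ((p.eval y : ℝ) : ℂ) := by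
  induction p using Polynomial.induction_on' with
  | add p q hp hq =>
    simpa only [Polynomial.eval_add, Complex.ofReal_add, mul_add, Pi.add_def] using hp.add hq
  | monomial n a =>
    have hr : Integrable fun y : ℝ => y ^ n * Real.exp (-y ^ 2) := by
      have := integrable_rpow_mul_exp_neg_mul_sq one_pos (s := n)
        (by have := n.cast_nonneg (α := ℝ); linarith)
      simpa using this
    refine (hr.norm.const_mul ‖a‖).mono' ?_ ?_
    · exact ((continuous_modulatedGaussian ξ).mul
        (Complex.continuous_ofReal.comp (Polynomial.continuous _))).aestronglyMeasurable
    · refine Filter.Eventually.of_forall fun y => le_of_eq ?_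
      simp only [norm_mul, norm_modulatedGaussian, eval_monomial, Complex.norm_real, Real.norm_eq_abs,
        abs_pow, Real.abs_exp]
      ring

open Polynomial in
/-- Integration of polynomials against `e^{-y² - iξy}`. -/
def gaussianFunctional (ξ : ℝ) : ℝ[X] →ₗ[ℝ] ℂ where
  toFun p := ∫ y : ℝ, modulatedGaussian ξ y * ((p.eval y : ℝ) : ℂ)
  map_add' p q := by
    rw [← integral_add (integrable_modulatedGaussian_mul_eval ξ p)
      (integrable_modulatedGaussian_mul_eval ξ q)]
    simp [mul_add]
  map_smul' a p := by
    rw [RingHom.id_apply, ← integral_smul]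
    refine integral_congr_ae (Filter.Eventually.of_forall fun y => ?_)
    simp only [eval_smul, smul_eq_mul, Complex.ofReal_mul, Complex.real_smul]
    ring

lemma gaussianFunctional_one (ξ : ℝ) :
    gaussianFunctional ξ 1 = (√π * Real.exp (-ξ ^ 2 / 4) : ℝ) := by
  have h := fourierIntegral_gaussian (b := 1) (by simp) (-ξ : ℂ)
  have e : gaussianFunctional ξ 1 =
      ∫ y : ℝ, Complex.exp (Complex.I * -ξ * y) * Complex.exp (-1 * (y : ℂ) ^ 2) := by
    refine integral_congr_ae (Filter.Eventually.of_forall fun y => ?_)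
    simp only [modulatedGaussian, Polynomial.eval_one, Complex.ofReal_one, mul_one,
      ← Complex.exp_add]
    congr 1
    ring
  rw [e, h, Real.sqrt_eq_rpow, Complex.ofReal_mul, Complex.ofReal_cpow pi_nonneg]
  simp

open Polynomial in
lemma gaussianFunctional_derivative (ξ : ℝ) (p : ℝ[X]) :
    gaussianFunctional ξ (derivative p) =
      gaussianFunctional ξ (2 * X * p) + Complex.I * ξ * gaussianFunctional ξ p := by
  have hI (q : ℝ[X]) := integrable_modulatedGaussian_mul_eval ξ q
  have hd (y : ℝ) : HasDerivAt (fun y : ℝ => modulatedGaussian ξ y * ((p.eval y : ℝ) : ℂ))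
      (modulatedGaussian ξ y * (((derivative p).eval y : ℝ) : ℂ) -
        (modulatedGaussian ξ y * (((2 * X * p).eval y : ℝ) : ℂ) +
          Complex.I * ξ * (modulatedGaussian ξ y * ((p.eval y : ℝ) : ℂ)))) y := by
    convert! (hasDerivAt_modulatedGaussian ξ y).mul (p.hasDerivAt y).ofReal_comp using 1
    simp
    ring
  have h2 : Integrable fun y : ℝ => modulatedGaussian ξ y * (((2 * X * p).eval y : ℝ) : ℂ) +
      Complex.I * ξ * (modulatedGaussian ξ y * ((p.eval y : ℝ) : ℂ)) :=
    (hI (2 * X * p)).add ((hI p).const_mul (Complex.I * ξ))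
  have h := integral_eq_zero_of_hasDerivAt_of_integrable hd ((hI _).sub h2) (hI p)
  rw [integral_sub (hI _) h2, integral_add (hI _) ((hI p).const_mul _), integral_const_mul,
    sub_eq_zero] at h
  exact h

open Polynomial in
/-- The Hermite polynomial translated by `c`. -/
def shiftedHermite (n : ℕ) (c : ℝ) : ℝ[X] := (physHermite n).comp (X + C c)

open Polynomial in
lemma shiftedHermite_succ (n : ℕ) (c : ℝ) :
    shiftedHermite (n + 1) c = 2 * X * shiftedHermite n c + (2 * c) • shiftedHermite n c -
      derivative (shiftedHermite n c) := by
  simp [shiftedHermite, physHermite, derivative_comp, smul_eq_C_mul, ← C_ofNat]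
  ring

open Polynomial in
lemma derivative_shiftedHermite_succ (n : ℕ) (c : ℝ) :
    derivative (shiftedHermite (n + 1) c) = (2 * (n + 1) : ℝ) • shiftedHermite n c := by
  simp [shiftedHermite, derivative_comp, derivative_physHermite_succ]

open Polynomial in
lemma gaussianFunctional_shiftedHermite_succ_mul (ξ c : ℝ) (n : ℕ) (q : ℝ[X]) :
    gaussianFunctional ξ (shiftedHermite (n + 1) c * q) =
      (2 * c - Complex.I * ξ) * gaussianFunctional ξ (shiftedHermite n c * q) +
        gaussianFunctional ξ (shiftedHermite n c * derivative q) := by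
  have h := gaussianFunctional_derivative ξ (shiftedHermite n c * q)
  have e : shiftedHermite (n + 1) c * q = 2 * X * (shiftedHermite n c * q) +
      (2 * c) • (shiftedHermite n c * q) - (derivative (shiftedHermite n c * q)) +
      shiftedHermite n c * derivative q := by
    rw [shiftedHermite_succ, derivative_mul]
    simp only [smul_eq_C_mul]
    ring
  rw [e, map_add, map_sub, map_add, h, map_smul, Complex.real_smul]
  push_cast
  ring

lemma gaussianFunctional_shiftedHermite (ξ c : ℝ) (n : ℕ) :
    gaussianFunctional ξ (shiftedHermite n c) =
      (2 * c - Complex.I * ξ) ^ n * gaussianFunctional ξ 1 := by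
  induction n with
  | zero => simp [shiftedHermite, physHermite]
  | succ n ih =>
    have h := gaussianFunctional_shiftedHermite_succ_mul ξ c n 1
    simp only [mul_one, Polynomial.derivative_one, mul_zero, map_zero, add_zero] at h
    rw [h, ih]
    ring

lemma gaussianFunctional_shiftedHermite_mul (ξ c c' : ℝ) (n m : ℕ) :
    gaussianFunctional ξ (shiftedHermite n c * shiftedHermite m c') =
      (∑ i ∈ Finset.range (n + 1), (n.choose i * m.choose i * i.factorial * 2 ^ i : ℂ) *
        (2 * c - Complex.I * ξ) ^ (n - i) * (2 * c' - Complex.I * ξ) ^ (m - i)) *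
          gaussianFunctional ξ 1 := by
  set a : ℂ := 2 * c - Complex.I * ξ with ha
  set b : ℂ := 2 * c' - Complex.I * ξ with hb
  induction n generalizing m with
  | zero =>
    have : shiftedHermite 0 c = 1 := by simp [shiftedHermite, physHermite]
    simp [this, gaussianFunctional_shiftedHermite, ← hb]
  | succ n ih =>
    rw [gaussianFunctional_shiftedHermite_succ_mul, ih, ← ha]
    have hsplit : ∑ i ∈ Finset.range (n + 1 + 1),
        ((n + 1).choose i * m.choose i * i.factorial * 2 ^ i : ℂ) * a ^ (n + 1 - i) * b ^ (m - i) =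
        a * ∑ i ∈ Finset.range (n + 1),
          (n.choose i * m.choose i * i.factorial * 2 ^ i : ℂ) * a ^ (n - i) * b ^ (m - i) +
        ∑ i ∈ Finset.range (n + 1),
          (n.choose i * m.choose (i + 1) * (i + 1).factorial * 2 ^ (i + 1) : ℂ) * a ^ (n - i) *
            b ^ (m - (i + 1)) := by
      have h1 : a * ∑ i ∈ Finset.range (n + 1),
          (n.choose i * m.choose i * i.factorial * 2 ^ i : ℂ) * a ^ (n - i) * b ^ (m - i) =
          ∑ i ∈ Finset.range (n + 1 + 1),
          (n.choose i * m.choose i * i.factorial * 2 ^ i : ℂ) * a ^ (n + 1 - i) * b ^ (m - i) := by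
        rw [Finset.sum_range_succ _ (n + 1)]
        simp only [Nat.choose_succ_self, Nat.cast_zero, zero_mul, add_zero, Finset.mul_sum]
        refine Finset.sum_congr rfl fun i hi => ?_
        rw [Nat.sub_add_comm (by simpa [Nat.lt_succ_iff] using hi), pow_succ]
        ring
      rw [h1, Finset.sum_range_succ' _ (n + 1), Finset.sum_range_succ' _ (n + 1), add_right_comm,
        ← Finset.sum_add_distrib]
      congr 1
      · refine Finset.sum_congr rfl fun i _ => ?_
        rw [Nat.choose_succ_succ, Nat.add_sub_add_right]
        push_cast
        ring
      · simp
    rw [hsplit, add_mul]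
    congr 1
    · ring
    · cases m with
      | zero => simp [shiftedHermite, physHermite]
      | succ m =>
        rw [derivative_shiftedHermite_succ, mul_smul_comm, map_smul, ih, Complex.real_smul,
          ← mul_assoc, Finset.mul_sum]
        congr 1
        refine Finset.sum_congr rfl fun i _ => ?_
        have h : ((m : ℂ) + 1) * m.choose i = (m + 1).choose (i + 1) * (i + 1) := by
          exact_mod_cast Nat.add_one_mul_choose_eq m i
        rw [Nat.factorial_succ, Nat.add_sub_add_right]
        push_cast
        linear_combination (2 * n.choose i * i.factorial * 2 ^ i * a ^ (n - i) * b ^ (m - i)) * h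

lemma gaussianFunctional_shiftedHermite_mul_self (ξ x : ℝ) (n : ℕ) :
    gaussianFunctional ξ (shiftedHermite n (x / 2) * shiftedHermite n (-(x / 2))) =
      ((2 ^ n * n.factorial * √π) * laguerre 0 n ((x ^ 2 + ξ ^ 2) / 2) *
        Real.exp (-ξ ^ 2 / 4) : ℝ) := by
  rw [gaussianFunctional_shiftedHermite_mul, gaussianFunctional_one]
  have key : ∑ i ∈ Finset.range (n + 1), (n.choose i * n.choose i * i.factorial * 2 ^ i : ℂ) *
        (2 * (x / 2 : ℝ) - Complex.I * ξ) ^ (n - i) *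
        (2 * (-(x / 2) : ℝ) - Complex.I * ξ) ^ (n - i) =
      (2 ^ n * n.factorial * laguerre 0 n ((x ^ 2 + ξ ^ 2) / 2) : ℝ) := by
    rw [laguerre, Finset.mul_sum, ← Finset.sum_range_reflect]
    push_cast
    refine Finset.sum_congr rfl fun i hi => ?_
    have hin : i ≤ n := by simpa [Nat.lt_succ_iff] using hi
    have hf : (n.choose i : ℂ) * i.factorial * (n - i).factorial = n.factorial := by
      exact_mod_cast Nat.choose_mul_factorial_mul_factorial hin
    have hi0 : (i.factorial : ℂ) ≠ 0 := by exact_mod_cast i.factorial_ne_zero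
    rw [show n - (n - i) = i by omega, add_zero,
      Nat.choose_symm hin, mul_assoc _ (_ ^ i) (_ ^ i), ← mul_pow,
      show (2 * ((x : ℂ) / 2) - Complex.I * ξ) * (2 * (-((x : ℂ) / 2)) - Complex.I * ξ) =
        2 * (-1) * ((x ^ 2 + ξ ^ 2) / 2) by linear_combination (ξ : ℂ) ^ 2 * Complex.I_sq,
      mul_pow, mul_pow, ← hf, show (2 : ℂ) ^ n = 2 ^ (n - i) * 2 ^ i by
        rw [← pow_add, Nat.sub_add_cancel hin]]
    field_simp
  rw [key]
  push_cast
  ring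

lemma hermiteFun_mul_hermiteFun (n : ℕ) (y x : ℝ) :
    hermiteFun n (y + x / 2) * hermiteFun n (y - x / 2) =
      (2 ^ n * n.factorial * √π)⁻¹ * Real.exp (-x ^ 2 / 4) * Real.exp (-y ^ 2) *
        (shiftedHermite n (x / 2) * shiftedHermite n (-(x / 2))).eval y := by
  have hpos : 0 < (2 : ℝ) ^ n * n.factorial * √π := by positivity
  have h1 : ((2 : ℝ) ^ n * n.factorial * √π) ^ (-(1 : ℝ) / 2) *
      ((2 : ℝ) ^ n * n.factorial * √π) ^ (-(1 : ℝ) / 2) = (2 ^ n * n.factorial * √π)⁻¹ := by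
    rw [← Real.rpow_add hpos, ← Real.rpow_neg_one]
    norm_num
  have h2 : Real.exp (-(y + x / 2) ^ 2 / 2) * Real.exp (-(y - x / 2) ^ 2 / 2) =
      Real.exp (-x ^ 2 / 4) * Real.exp (-y ^ 2) := by
    rw [← Real.exp_add, ← Real.exp_add]
    congr 1
    ring
  have h3 : (shiftedHermite n (x / 2) * shiftedHermite n (-(x / 2))).eval y =
      hermitePoly n (y + x / 2) * hermitePoly n (y - x / 2) := by
    simp [shiftedHermite, hermitePoly_eq_eval, sub_eq_add_neg]
  rw [h3, hermiteFun, hermiteFun, ← h1]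
  linear_combination (-(((2 : ℝ) ^ n * n.factorial * √π) ^ (-(1 : ℝ) / 2)) ^ 2 *
    hermitePoly n (y + x / 2) * hermitePoly n (y - x / 2)) * (-h2)

lemma integral_cexp_mul_hermiteFun_mul_hermiteFun (n : ℕ) (x ξ : ℝ) :
    ∫ y : ℝ, Complex.exp (-Complex.I * (ξ * y : ℝ)) *
        (hermiteFun n (y + x / 2) * hermiteFun n (y - x / 2) : ℝ) =
      (laguerre 0 n ((x ^ 2 + ξ ^ 2) / 2) * Real.exp (-(x ^ 2 + ξ ^ 2) / 4) : ℝ) := by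
  have e : ∀ y : ℝ, Complex.exp (-Complex.I * (ξ * y : ℝ)) *
        (hermiteFun n (y + x / 2) * hermiteFun n (y - x / 2) : ℝ) =
      ((2 ^ n * n.factorial * √π)⁻¹ * Real.exp (-x ^ 2 / 4) : ℝ) *
        (modulatedGaussian ξ y *
          ((shiftedHermite n (x / 2) * shiftedHermite n (-(x / 2))).eval y : ℝ)) := by
    intro y
    have h : modulatedGaussian ξ y =
        Complex.exp (-Complex.I * (ξ * y : ℝ)) * (Real.exp (-y ^ 2) : ℝ) := by
      rw [modulatedGaussian, Complex.ofReal_exp, ← Complex.exp_add]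
      congr 1
      push_cast
      ring
    rw [hermiteFun_mul_hermiteFun, h]
    push_cast
    ring
  simp_rw [e]
  rw [integral_const_mul]
  have hpos : (2 : ℝ) ^ n * n.factorial * √π ≠ 0 := by positivity
  refine (congrArg (_ * ·) (gaussianFunctional_shiftedHermite_mul_self ξ x n)).trans ?_
  rw [← Complex.ofReal_mul,
    show -(x ^ 2 + ξ ^ 2) / 4 = -x ^ 2 / 4 + -ξ ^ 2 / 4 by ring, Real.exp_add]
  congr 1
  field_simp

lemma two_pi_pow_mul_specialHermite {d : ℕ} (β : Fin d → ℕ) (z : (Fin d → ℝ) × (Fin d → ℝ)) :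
    ((2 * π : ℝ) ^ d : ℝ) * specialHermite β β z =
      (∏ j, laguerre 0 (β j) ((z.1 j ^ 2 + z.2 j ^ 2) / 2) *
        Real.exp (-(z.1 j ^ 2 + z.2 j ^ 2) / 4) : ℝ) := by
  have hpi : ((2 * π : ℝ) ^ d) ≠ 0 := by positivity
  rw [specialHermite, ambiguity, ← mul_assoc, ← Complex.ofReal_mul, mul_inv_cancel₀ hpi,
    Complex.ofReal_one, one_mul, Complex.ofReal_prod]
  have hj (j : Fin d) := integral_cexp_mul_hermiteFun_mul_hermiteFun (β j) (z.2 j) (-z.1 j)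
  simp only [neg_sq, add_comm (z.2 _ ^ 2)] at hj
  simp_rw [← hj]
  rw [← integral_fintype_prod_volume_eq_prod]
  refine integral_congr_ae (Filter.Eventually.of_forall fun y => ?_)
  simp only [hermiteFunD, dotp, Complex.conj_ofReal]
  simp only [Finset.prod_mul_distrib, ← Complex.exp_sum,
    ← Finset.mul_sum, Complex.ofReal_mul, Complex.ofReal_prod, Complex.ofReal_sum, mul_assoc]
  simp [div_eq_inv_mul]

/-- The sum of the diagonal special Hermite functions over multi-indices of length
`k` is a Laguerre function:
`(2π)^d ∑_{|β|=k} Φ_{β,β}(z) = L_k^{d-1}(|z|²/2) e^{-|z|²/4}`. -/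
theorem sum_specialHermite_diag {d : ℕ} (hd : 1 ≤ d) (k : ℕ)
    (z : (Fin d → ℝ) × (Fin d → ℝ)) :
    ((2 * π : ℝ) ^ d : ℝ) *
        ∑' β : {β : Fin d → ℕ // ∑ j, β j = k}, specialHermite β.1 β.1 z =
      ((laguerre (d - 1) k ((∑ j, z.1 j ^ 2 + ∑ j, z.2 j ^ 2) / 2) *
          Real.exp (-(∑ j, z.1 j ^ 2 + ∑ j, z.2 j ^ 2) / 4) : ℝ) : ℂ) := by
  obtain ⟨d, rfl⟩ : ∃ e, d = e + 1 := ⟨d - 1, by omega⟩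
  rw [← tsum_mul_left]
  simp_rw [two_pi_pow_mul_specialHermite, Finset.prod_mul_distrib]
  rw [← Complex.ofReal_tsum, tsum_mul_right, ← Real.exp_sum,
    tsum_prod_laguerre d k fun j => (z.1 j ^ 2 + z.2 j ^ 2) / 2, ← Finset.sum_div,
    ← Finset.sum_div, Finset.sum_neg_distrib, Finset.sum_add_distrib, Nat.add_sub_cancel]

end
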